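/- Let ⋆ be a relation defined on the filters on every set which is sup-compatible on every set and ×-compatible, and let J be a class of filters, given on every set, which is steady on every set, F_1-composable, and contains all principal filters. For a filter F on a set X the following are equivalent: (a) F ∈ ker(J^⋆); (b) for every set Y and every filter G ∈ ker(J^{⋆⋆})(Y), the product filter F × G belongs to ker(J^⋆)(X×Y); (c) for every set Y and every G ∈ J(Y), F × G ∈ J^⋆(X×Y); (d) for every set Y and every G ∈ J(Y), F × G ∈ F_1^⋆(X×Y). -/

import Mathlib

open Filter Set

universe u

/-- Two filters mesh if all their members intersect, i.e. the filter generated by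
pairwise intersections (which is `F ⊓ G` in Mathlib's order) is proper. -/
def Mesh {Z : Type u} (F G : Filter Z) : Prop := Filter.NeBot (F ⊓ G)

/-- The image filter `AF` of a filter `F` on `X` under a set `A ⊆ X × Y`:
generated by the sets `A(F) = {y | ∃ x ∈ F, (x, y) ∈ A}`. -/
def imgSet {X Y : Type u} (A : Set (X × Y)) (F : Filter X) : Filter Y :=
  ⨅ f ∈ F, 𝓟 {y | ∃ x ∈ f, (x, y) ∈ A}

/-- A relation on filters (given on every set) is sup-compatible on `Z` if it is
symmetric, holds for non-meshing pairs, and satisfies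
`F ⋆ (G ∨ H) → (F ∨ H) ⋆ G` when `G # F` and `F # H` (the paper's `∨` is `⊓`). -/
def SupCompatible {Z : Type u} (r : Filter Z → Filter Z → Prop) : Prop :=
  (∀ F G, r F G → r G F) ∧
  (∀ F G, ¬ Mesh F G → r F G) ∧
  (∀ F G H, Mesh G F → Mesh F H → r F (G ⊓ H) → r (F ⊓ H) G)

/-- A relation given on the filters on every set is `×`-compatible if
`(F × G) ⋆ A → G ⋆ (AF)`. -/
def TimesCompatible (r : ∀ Z : Type u, Filter Z → Filter Z → Prop) : Prop :=
  ∀ (X Y : Type u) (F : Filter X) (G : Filter Y) (A : Set (X × Y)),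
    r (X × Y) (F ×ˢ G) (𝓟 A) → r Y G (imgSet A F)

/-- The polar `J^⋆` taken on every set. -/
def polarC (r : ∀ Z : Type u, Filter Z → Filter Z → Prop)
    (J : ∀ Z : Type u, Set (Filter Z)) : ∀ Z : Type u, Set (Filter Z) :=
  fun Z => {F | ∀ G ∈ J Z, r Z F G}

/-- The kernel of a class: filters all of whose images under relations stay in the class. -/
def kerC (M : ∀ Z : Type u, Set (Filter Z)) : ∀ X : Type u, Set (Filter X) :=
  fun X => {F | ∀ (Y : Type u) (A : Set (X × Y)), imgSet A F ∈ M Y}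

/-- The class of principal filters. -/
def F1 : ∀ Z : Type u, Set (Filter Z) := fun Z => {G | ∃ A : Set Z, G = 𝓟 A}

/-- A class of filters is `F_1`-composable if it is stable under images by relations. -/
def F1Composable (J : ∀ Z : Type u, Set (Filter Z)) : Prop :=
  ∀ (X Y : Type u), ∀ F ∈ J X, ∀ A : Set (X × Y), imgSet A F ∈ J Y

theorem mem_imgSet {X Y : Type u} {A : Set (X × Y)} {F : Filter X} {s : Set Y} :
    s ∈ imgSet A F ↔ ∃ t ∈ F, {y | ∃ x ∈ t, (x, y) ∈ A} ⊆ s :=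
  Filter.mem_lift'_sets (f := F) (h := fun t => {y | ∃ x ∈ t, (x, y) ∈ A})
    fun _ _ hst _ ⟨x, hx, hxy⟩ => ⟨x, hst hx, hxy⟩

theorem imgSet_graph_restrict {X W : Type u} (f : W → X) (A : Set W) (F : Filter X) :
    imgSet {p : X × W | f p.2 = p.1 ∧ p.2 ∈ A} F = comap f F ⊓ 𝓟 A := by
  ext s
  rw [mem_imgSet, mem_inf_principal, mem_comap]
  refine exists_congr fun t => and_congr_right fun _ => ⟨?_, ?_⟩
  · exact fun h w hw hA => h ⟨f w, hw, rfl, hA⟩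
  · rintro h w ⟨x, hx, hxw, hA⟩
    exact h (show f w ∈ t from hxw ▸ hx) hA

theorem imgSet_graph {X W : Type u} (f : W → X) (F : Filter X) :
    imgSet {p : X × W | f p.2 = p.1 ∧ p.2 ∈ (univ : Set W)} F = comap f F := by
  rw [imgSet_graph_restrict, principal_univ, inf_top_eq]

theorem Mesh.symm {Z : Type u} {F G : Filter Z} (h : Mesh F G) : Mesh G F := by
  rwa [Mesh, inf_comm]

theorem Mesh.mono {Z : Type u} {F F' G G' : Filter Z} (h : Mesh F G) (hF : F ≤ F')
    (hG : G ≤ G') : Mesh F' G' :=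
  NeBot.mono h (inf_le_inf hF hG)

/-- The exchange law of a sup-compatible relation holds without meshing assumptions. -/
theorem SupCompatible.exchange {Z : Type u} {r : Filter Z → Filter Z → Prop}
    (h : SupCompatible r) {F G H : Filter Z} (hr : r F (G ⊓ H)) : r (F ⊓ H) G := by
  by_cases hm : Mesh (F ⊓ H) G
  · refine h.2.2 F G H (hm.symm.mono le_rfl inf_le_left) ?_ hr
    exact NeBot.mono hm inf_le_left
  · exact h.2.1 _ _ hm

theorem comap_inf_mem_polarC {r : ∀ Z : Type u, Filter Z → Filter Z → Prop}
    (hsup : ∀ Z : Type u, SupCompatible (r Z)) {J : ∀ Z : Type u, Set (Filter Z)}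
    (hsteady : ∀ (Z : Type u), ∀ F ∈ J Z, ∀ G ∈ J Z, Mesh F G → F ⊓ G ∈ J Z)
    {X W : Type u} {F : Filter X} (hF : F ∈ kerC (polarC r J) X) (f : W → X)
    {H : Filter W} (hH : H ∈ J W) : comap f F ⊓ H ∈ polarC r J W := by
  intro K hK
  by_cases hm : Mesh K H
  · have hc := hF W {p | f p.2 = p.1 ∧ p.2 ∈ univ}
    rw [imgSet_graph] at hc
    exact (hsup W).exchange (hc _ (hsteady W K hK H hH hm))
  · refine (hsup W).2.1 _ _ fun h => hm ?_
    exact h.symm.mono le_rfl inf_le_right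

theorem comap_mem_of_F1Composable {J : ∀ Z : Type u, Set (Filter Z)} (hcomp : F1Composable J)
    {X W : Type u} (f : W → X) {G : Filter X} (hG : G ∈ J X) : comap f G ∈ J W := by
  rw [← imgSet_graph]
  exact hcomp _ _ _ hG _

theorem kerC_subset (M : ∀ Z : Type u, Set (Filter Z)) (X : Type u) : kerC M X ⊆ M X := by
  intro F hF
  have h := hF X {p | id p.2 = p.1 ∧ p.2 ∈ univ}
  rwa [imgSet_graph, comap_id] at h

theorem subset_polarC_polarC {r : ∀ Z : Type u, Filter Z → Filter Z → Prop}
    (hsup : ∀ Z : Type u, SupCompatible (r Z)) (J : ∀ Z : Type u, Set (Filter Z))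
    (Z : Type u) : J Z ⊆ polarC r (polarC r J) Z :=
  fun F hF G hG => (hsup Z).1 G F (hG F hF)

theorem stmt10 (r : ∀ Z : Type u, Filter Z → Filter Z → Prop)
    (hsup : ∀ Z : Type u, SupCompatible (r Z)) (htimes : TimesCompatible r)
    (J : ∀ Z : Type u, Set (Filter Z))
    (hsteady : ∀ (Z : Type u), ∀ F ∈ J Z, ∀ G ∈ J Z, Mesh F G → F ⊓ G ∈ J Z)
    (hcomp : F1Composable J)
    (hprin : ∀ (Z : Type u) (A : Set Z), 𝓟 A ∈ J Z)
    (X : Type u) (F : Filter X) :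
    List.TFAE [
      -- (a) F ∈ ker(J^⋆)
      F ∈ kerC (polarC r J) X,
      -- (b) F × G ∈ ker(J^⋆) for every G ∈ ker(J^{⋆⋆})
      ∀ (Y : Type u), ∀ G ∈ kerC (polarC r (polarC r J)) Y,
        F ×ˢ G ∈ kerC (polarC r J) (X × Y),
      -- (c) F × G ∈ J^⋆ for every G ∈ J
      ∀ (Y : Type u), ∀ G ∈ J Y, F ×ˢ G ∈ polarC r J (X × Y),
      -- (d) F × G ∈ F_1^⋆ for every G ∈ J
      ∀ (Y : Type u), ∀ G ∈ J Y, F ×ˢ G ∈ polarC r F1 (X × Y)] := by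
  tfae_have 1 → 2 := by
    intro hF Y G hG Z A H hH
    refine (hsup Z).1 _ _ (htimes _ _ _ _ _ ?_)
    have hQ : comap (fun w : (X × Y) × Z => w.1.1) F ⊓ comap Prod.snd H ∈
        polarC r J ((X × Y) × Z) :=
      comap_inf_mem_polarC hsup hsteady hF _ (comap_mem_of_F1Composable hcomp _ hH)
    have hP := hG _ {p : Y × ((X × Y) × Z) | p.2.1.2 = p.1 ∧ p.2 ∈ A}
    rw [imgSet_graph_restrict (fun w : (X × Y) × Z => w.1.2), inf_comm] at hP
    have h := (hsup _).exchange ((hsup _).1 _ _ (hP _ hQ))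
    convert h using 1
    simp only [prod_eq_inf, comap_inf, comap_comap]
    exact inf_right_comm _ _ _
  tfae_have 2 → 3 := fun h Y G hG => kerC_subset _ _ <| h Y G fun Z A =>
    subset_polarC_polarC hsup J Z (hcomp Y Z G hG A)
  tfae_have 3 → 4 := by
    rintro h Y G hG _ ⟨A, rfl⟩
    exact h Y G hG _ (hprin _ A)
  tfae_have 4 → 1 := fun h Y A G hG =>
    (hsup Y).1 _ _ (htimes _ _ _ _ _ (h Y G hG _ ⟨A, rfl⟩))
  tfae_finish
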